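/- arXiv:1412.4347 — 2 statements merged into one kernel-verified Lean document; each statement's English description precedes it below -/
import Mathlib

section
/- There exists a function q : ℝ → ℝ which is twice continuously differentiable on ℝ, satisfies q''(s)·q(s) + a·s·q'(s)·q(s) + μ·q(s) + (1/3)·s·q'(s) = 0 for all s ∈ ℝ with q(0) = A and q'(0) = 0, and moreover: q(s) > 0 for all s ∈ ℝ, q is even (q(-s) = q(s) for all s), q is strictly decreasing on (0, ∞), q(s) → 0 and q'(s) → 0 as s → ∞, the functions q, q², and (q')² are all integrable over ℝ, and (μ - 1/3)·∫_ℝ q(s) ds = ∫_ℝ q'(s)² ds + (a/2)·∫_ℝ q(s)² ds. -/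
open MeasureTheory Filter Real

/-- Global integral curves of a vector field which is uniformly Lipschitz on bounded time intervals
are determined by their value at time `0`. -/
theorem global_integral_curve_unique {E : Type*} [NormedAddCommGroup E] [NormedSpace ℝ E]
    {f : ℝ → E → E} (hL : ∀ T : ℝ, ∃ K : NNReal, ∀ t ∈ Set.Icc (-T) T, LipschitzWith K (f t))
    {x y : ℝ → E} (hx : ∀ t, HasDerivAt x (f t (x t)) t) (hy : ∀ t, HasDerivAt y (f t (y t)) t)
    (h0 : x 0 = y 0) : x = y := by
  funext t
  obtain ⟨K, hK⟩ := hL (|t| + 1)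
  have ht := abs_nonneg t
  refine ODE_solution_unique_of_mem_Ioo (v := f) (K := K) (s := fun _ => Set.univ) (t₀ := 0)
    (a := -(|t| + 1)) (b := |t| + 1)
    (fun t ht => (hK t (Set.Ioo_subset_Icc_self ht)).lipschitzOnWith)
    (by constructor <;> linarith) (fun t _ => ⟨hx t, trivial⟩) (fun t _ => ⟨hy t, trivial⟩) h0
    (abs_lt.1 (lt_add_one _))

/-- A time-dependent vector field which, on every bounded time interval, is bounded and uniformly
Lipschitz admits a global integral curve through every initial value. -/
theorem exists_global_integral_curve {E : Type*} [NormedAddCommGroup E] [NormedSpace ℝ E]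
    [CompleteSpace E] (f : ℝ → E → E) (hf : ∀ x, Continuous fun t => f t x)
    (hL : ∀ T : ℝ, ∃ K : NNReal, ∀ t ∈ Set.Icc (-T) T, LipschitzWith K (f t))
    (hB : ∀ T : ℝ, ∃ C : NNReal, ∀ t ∈ Set.Icc (-T) T, ∀ x, ‖f t x‖ ≤ C) (x₀ : E) :
    ∃ x : ℝ → E, x 0 = x₀ ∧ ∀ t, HasDerivAt x (f t (x t)) t := by
  have local_sol (n : ℕ) : ∃ x : ℝ → E, x 0 = x₀ ∧
      ∀ t ∈ Set.Ioo (-((n : ℝ) + 1)) ((n : ℝ) + 1), HasDerivAt x (f t (x t)) t := by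
    obtain ⟨K, hK⟩ := hL ((n : ℝ) + 1)
    obtain ⟨C, hC⟩ := hB ((n : ℝ) + 1)
    have hn : (0 : ℝ) ≤ n := n.cast_nonneg
    have hPL : IsPicardLindelof f (tmin := -((n : ℝ) + 1)) (tmax := (n : ℝ) + 1)
        ⟨0, by constructor <;> linarith⟩ x₀ (C * (n + 1)) 0 C K :=
      { lipschitzOnWith := fun t ht => (hK t ht).lipschitzOnWith
        continuousOn := fun x _ => (hf x).continuousOn
        norm_le := fun t ht x _ => hC t ht x
        mul_max_le := by simp }
    obtain ⟨x, hx0, hx⟩ := hPL.exists_eq_forall_mem_Icc_hasDerivWithinAt₀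
    exact ⟨x, hx0, fun t ht => (hx t (Set.Ioo_subset_Icc_self ht)).hasDerivAt
      (Icc_mem_nhds ht.1 ht.2)⟩
  choose x hx0 hx using local_sol
  have agree (m n : ℕ) (hmn : m ≤ n) :
      Set.EqOn (x m) (x n) (Set.Ioo (-((m : ℝ) + 1)) ((m : ℝ) + 1)) := by
    obtain ⟨K, hK⟩ := hL ((m : ℝ) + 1)
    have hm : (0 : ℝ) ≤ m := m.cast_nonneg
    have hmn' : (m : ℝ) ≤ n := by exact_mod_cast hmn
    refine ODE_solution_unique_of_mem_Ioo (v := f) (K := K) (s := fun _ => Set.univ) (t₀ := 0)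
      (fun t ht => (hK t (Set.Ioo_subset_Icc_self ht)).lipschitzOnWith)
      (by constructor <;> linarith) (fun t ht => ⟨hx m t ht, trivial⟩)
      (fun t ht => ⟨hx n t ⟨?_, ?_⟩, trivial⟩) (by rw [hx0, hx0])
    · linarith [ht.1]
    · linarith [ht.2]
  refine ⟨fun t => x ⌈|t|⌉₊ t, by simp [hx0], fun t => ?_⟩
  have key (n : ℕ) (s : ℝ) (hs : |s| < (n : ℝ) + 1) : x ⌈|s|⌉₊ s = x n s := by
    have hs' : |s| < (⌈|s|⌉₊ : ℝ) + 1 := (Nat.le_ceil _).trans_lt (lt_add_one _)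
    rcases le_total ⌈|s|⌉₊ n with h | h
    · exact agree _ _ h (abs_lt.1 hs')
    · exact (agree _ _ h (abs_lt.1 hs)).symm
  have ht : |t| < (⌈|t|⌉₊ : ℝ) + 1 := (Nat.le_ceil _).trans_lt (lt_add_one _)
  refine (hx ⌈|t|⌉₊ t (abs_lt.1 ht)).congr_of_eventuallyEq ?_
  filter_upwards [continuous_abs.continuousAt.eventually_lt continuousAt_const ht] with s hs
  exact key _ s hs

/-- An even function on `ℝ` which is integrable on `(0, ∞)` is integrable. -/
theorem integrable_of_even {f : ℝ → ℝ} (heven : ∀ s, f (-s) = f s)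
    (hf : IntegrableOn f (Set.Ioi 0)) : Integrable f := by
  rw [← integrableOn_univ, ← Set.Iic_union_Ioi (a := (0 : ℝ))]
  refine IntegrableOn.union ?_ hf
  have h : IntegrableOn f (Set.Ici 0) := Iff.mpr integrableOn_Ici_iff_integrableOn_Ioi hf
  rw [← neg_zero] at h
  simpa [heven] using h.comp_neg_Iic

/-- The projection of `p` onto the interval `[-m, m]`. -/
noncomputable def clamp (m p : ℝ) : ℝ := max (-m) (min p m)

theorem abs_clamp_le {m : ℝ} (hm : 0 ≤ m) (p : ℝ) : |clamp m p| ≤ m := by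
  rw [abs_le]
  exact ⟨le_max_left _ _, max_le (by linarith) (min_le_right _ _)⟩

theorem abs_clamp_sub_clamp_le (m p p' : ℝ) : |clamp m p - clamp m p'| ≤ |p - p'| := by
  unfold clamp
  refine (abs_max_sub_max_le_max _ _ _ _).trans ?_
  simpa using abs_min_sub_min_le_max p m p' m

theorem clamp_of_abs_le {m p : ℝ} (h : |p| ≤ m) : clamp m p = p := by
  rw [abs_le] at h
  simp [clamp, h.1, h.2]

theorem clamp_neg {m : ℝ} (hm : 0 ≤ m) (p : ℝ) : clamp m (-p) = -clamp m p := by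
  unfold clamp
  grind

theorem clamp_nonpos {m p : ℝ} (hm : 0 ≤ m) (hp : p ≤ 0) : clamp m p ≤ 0 :=
  max_le (by linarith) ((min_le_left _ _).trans hp)

theorem continuous_clamp (p : ℝ) : Continuous fun m => clamp m p := by
  unfold clamp
  fun_prop

/-- The first-order system for `(q, q')`, made globally bounded and Lipschitz by truncating `q'` at
`μ |s|` and bounding `q` from below by `ε s`. -/
noncomputable def truncatedField (a μ : ℝ) (ε : ℝ → ℝ) (s : ℝ) (x : ℝ × ℝ) : ℝ × ℝ :=
  (clamp (μ * |s|) x.2, -μ - s * clamp (μ * |s|) x.2 * (a + 1 / (3 * max x.1 (ε s))))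

theorem continuous_truncatedField (a μ : ℝ) {ε : ℝ → ℝ} (hε : Continuous ε) (hpos : ∀ s, 0 < ε s)
    (x : ℝ × ℝ) : Continuous fun s => truncatedField a μ ε s x := by
  have h := (continuous_clamp x.2).comp (continuous_const.mul continuous_abs : Continuous
    fun s : ℝ => μ * |s|)
  have h' : Continuous fun s => 1 / (3 * max x.1 (ε s)) := by
    refine continuous_const.div (by fun_prop) fun s => ?_
    have := (hpos s).trans_le (le_max_right x.1 (ε s))
    positivity
  simp only [Function.comp_def] at h
  unfold truncatedField
  fun_prop

theorem abs_one_div_three_mul_sub_le {e x y : ℝ} (he : 0 < e) (hx : e ≤ x) (hy : e ≤ y) :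
    |1 / (3 * x) - 1 / (3 * y)| ≤ 1 / (3 * e ^ 2) * |x - y| := by
  have hx0 := he.trans_le hx
  have hy0 := he.trans_le hy
  have h : 1 / (3 * x) - 1 / (3 * y) = 1 / (3 * (x * y)) * (y - x) := by
    field_simp
  rw [h, abs_mul, abs_sub_comm y x, abs_of_pos (by positivity : 0 < 1 / (3 * (x * y)))]
  have : e ^ 2 ≤ x * y := by nlinarith
  gcongr

section TruncatedField

variable {a μ T s : ℝ} {ε : ℝ → ℝ}

theorem abs_weight_le (ha : 0 < a) (hpos : 0 < ε T) (hT : ε T ≤ ε s) (x : ℝ) :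
    |a + 1 / (3 * max x (ε s))| ≤ a + 1 / (3 * ε T) := by
  have h := hT.trans (le_max_right x (ε s))
  have := hpos.trans_le h
  rw [abs_of_pos (by positivity)]
  gcongr

theorem norm_truncatedField_le (ha : 0 < a) (hμ : 0 < μ) (hpos : 0 < ε T) (hT : ε T ≤ ε s)
    (hs : |s| ≤ T) (x : ℝ × ℝ) : ‖truncatedField a μ ε s x‖ ≤
      μ * T + μ + T * (μ * T) * (a + 1 / (3 * ε T)) := by
  have hT0 : 0 ≤ T := (abs_nonneg s).trans hs
  have hc : |clamp (μ * |s|) x.2| ≤ μ * T :=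
    (abs_clamp_le (by positivity) _).trans (by gcongr)
  have hw := abs_weight_le ha hpos hT x.1
  rw [truncatedField, Prod.norm_def, Real.norm_eq_abs, Real.norm_eq_abs]
  refine max_le (hc.trans ?_) ?_
  · have : 0 ≤ T * (μ * T) * (a + 1 / (3 * ε T)) := by positivity
    linarith
  · refine (abs_sub _ _).trans ?_
    rw [abs_neg, abs_of_pos hμ, abs_mul, abs_mul]
    have : |s| * |clamp (μ * |s|) x.2| * |a + 1 / (3 * max x.1 (ε s))| ≤
        T * (μ * T) * (a + 1 / (3 * ε T)) := by gcongr
    have : 0 ≤ μ * T := by positivity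
    linarith

theorem dist_truncatedField_le (ha : 0 < a) (hμ : 0 < μ) (hpos : 0 < ε T) (hT : ε T ≤ ε s)
    (hs : |s| ≤ T) (x y : ℝ × ℝ) : dist (truncatedField a μ ε s x) (truncatedField a μ ε s y) ≤
      (1 + T * (μ * T * (1 / (3 * ε T ^ 2)) + (a + 1 / (3 * ε T)))) * dist x y := by
  have hT0 : 0 ≤ T := (abs_nonneg s).trans hs
  have hc : |clamp (μ * |s|) x.2| ≤ μ * T :=
    (abs_clamp_le (by positivity) _).trans (by gcongr)
  have hw := abs_weight_le ha hpos hT y.1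
  have hd1 : |x.1 - y.1| ≤ dist x y := le_max_left (dist x.1 y.1) (dist x.2 y.2)
  have hd2 : |x.2 - y.2| ≤ dist x y := le_max_right (dist x.1 y.1) (dist x.2 y.2)
  have hd0 : 0 ≤ dist x y := dist_nonneg
  have hcc : |clamp (μ * |s|) x.2 - clamp (μ * |s|) y.2| ≤ dist x y :=
    (abs_clamp_sub_clamp_le _ _ _).trans hd2
  have hww : |1 / (3 * max x.1 (ε s)) - 1 / (3 * max y.1 (ε s))| ≤
      1 / (3 * ε T ^ 2) * dist x y := by
    refine (abs_one_div_three_mul_sub_le hpos (hT.trans (le_max_right _ _))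
      (hT.trans (le_max_right _ _))).trans ?_
    gcongr
    exact (abs_max_sub_max_le_abs _ _ _).trans hd1
  rw [truncatedField, truncatedField, Prod.dist_eq, Real.dist_eq, Real.dist_eq]
  refine max_le (hcc.trans ?_) ?_
  · have : 0 ≤ T * (μ * T * (1 / (3 * ε T ^ 2)) + (a + 1 / (3 * ε T))) * dist x y := by positivity
    linarith
  · generalize clamp (μ * |s|) x.2 = c at *
    generalize clamp (μ * |s|) y.2 = c' at *
    generalize 1 / (3 * max x.1 (ε s)) = w at *
    generalize 1 / (3 * max y.1 (ε s)) = w' at *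
    have h : -μ - s * c * (a + w) - (-μ - s * c' * (a + w')) =
        -(s * (c * (w - w') + (c - c') * (a + w'))) := by ring
    rw [h, abs_neg, abs_mul]
    calc |s| * |c * (w - w') + (c - c') * (a + w')|
        ≤ |s| * (|c| * |w - w'| + |c - c'| * |a + w'|) := by
          gcongr
          exact (abs_add_le _ _).trans_eq (by rw [abs_mul, abs_mul])
      _ ≤ T * (μ * T * (1 / (3 * ε T ^ 2) * dist x y) + dist x y * (a + 1 / (3 * ε T))) := by
          gcongr
      _ ≤ _ := by linarith

end TruncatedField

/-- The truncated system has a global solution starting at `(A, 0)` whose first component is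
even. -/
theorem exists_truncated_solution {a μ A : ℝ} {ε : ℝ → ℝ} (ha : 0 < a) (hμ : 0 < μ)
    (hε : Continuous ε) (hpos : ∀ s, 0 < ε s) (heven : ∀ s, ε (-s) = ε s)
    (hanti : ∀ s T, |s| ≤ T → ε T ≤ ε s) :
    ∃ q p : ℝ → ℝ, q 0 = A ∧ p 0 = 0 ∧ (∀ s, q (-s) = q s) ∧ (∀ s, p (-s) = -p s) ∧
      (∀ s, HasDerivAt q (clamp (μ * |s|) (p s)) s) ∧
      ∀ s, HasDerivAt p (-μ - s * clamp (μ * |s|) (p s) * (a + 1 / (3 * max (q s) (ε s)))) s := by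
  have hL : ∀ T : ℝ, ∃ K : NNReal, ∀ t ∈ Set.Icc (-T) T,
      LipschitzWith K (truncatedField a μ ε t) := fun T =>
    ⟨Real.toNNReal (1 + T * (μ * T * (1 / (3 * ε T ^ 2)) + (a + 1 / (3 * ε T)))), fun t ht =>
      LipschitzWith.of_dist_le_mul fun x y => by
        have ht := abs_le.2 ht
        refine (dist_truncatedField_le ha hμ (hpos T) (hanti t T ht) ht x y).trans ?_
        gcongr
        exact Real.le_coe_toNNReal _⟩
  have hB : ∀ T : ℝ, ∃ C : NNReal, ∀ t ∈ Set.Icc (-T) T, ∀ x,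
      ‖truncatedField a μ ε t x‖ ≤ C := fun T =>
    ⟨Real.toNNReal (μ * T + μ + T * (μ * T) * (a + 1 / (3 * ε T))), fun t ht x => by
      have ht := abs_le.2 ht
      exact (norm_truncatedField_le ha hμ (hpos T) (hanti t T ht) ht x).trans
        (Real.le_coe_toNNReal _)⟩
  obtain ⟨x, hx0, hx⟩ := exists_global_integral_curve (truncatedField a μ ε)
    (continuous_truncatedField a μ hε hpos) hL hB (A, 0)
  have hq (s : ℝ) : HasDerivAt (fun t => (x t).1) (clamp (μ * |s|) (x s).2) s := (hx s).fst
  have hp (s : ℝ) : HasDerivAt (fun t => (x t).2)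
      (-μ - s * clamp (μ * |s|) (x s).2 * (a + 1 / (3 * max (x s).1 (ε s)))) s := (hx s).snd
  have hrefl : (fun s => ((x (-s)).1, -(x (-s)).2)) = x := by
    refine global_integral_curve_unique hL (fun s => ?_) hx (by simp [hx0])
    have h1 := (hq (-s)).comp s (hasDerivAt_neg s)
    have h2 := ((hp (-s)).comp s (hasDerivAt_neg s)).neg
    have hc := clamp_neg (by positivity : 0 ≤ μ * |s|) (x (-s)).2
    refine (h1.prodMk h2).congr_deriv ?_
    ext
    · simp [truncatedField, hc]
    · simp [truncatedField, hc, heven]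
  refine ⟨fun t => (x t).1, fun t => (x t).2, by simp [hx0], by simp [hx0], fun s => ?_,
    fun s => ?_, hq, hp⟩
  · exact (Prod.ext_iff.1 (congrFun hrefl s)).1
  · have h := (Prod.ext_iff.1 (congrFun hrefl s)).2
    simp only at h
    linarith

section Bounds

variable {a μ A s : ℝ} {ε q p : ℝ → ℝ}

theorem truncated_deriv_nonpos (hμ : 0 < μ) (hp0 : p 0 = 0)
    (hp : ∀ s, HasDerivAt p
      (-μ - s * clamp (μ * |s|) (p s) * (a + 1 / (3 * max (q s) (ε s)))) s)
    (hs : 0 ≤ s) : p s ≤ 0 := by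
  refine image_le_of_deriv_right_lt_deriv_boundary (a := 0) (b := s) (B := fun _ => 0)
    (B' := fun _ => 0) (fun t _ => (hp t).continuousAt.continuousWithinAt)
    (fun t _ => (hp t).hasDerivWithinAt) hp0.le (fun t => hasDerivAt_const t 0)
    (fun t _ h => ?_) (Set.right_mem_Icc.2 hs)
  have hc : clamp (μ * |t|) 0 = 0 := clamp_of_abs_le (by rw [abs_zero]; positivity)
  rw [h, hc]
  simpa using hμ

theorem truncated_neg_mul_le_deriv (ha : 0 < a) (hμ : 0 < μ) (hpos : ∀ s, 0 < ε s) (hp0 : p 0 = 0)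
    (hp : ∀ s, HasDerivAt p
      (-μ - s * clamp (μ * |s|) (p s) * (a + 1 / (3 * max (q s) (ε s)))) s)
    (hs : 0 ≤ s) : -(μ * s) ≤ p s := by
  have hmono : MonotoneOn (fun t => p t + μ * t) (Set.Ici 0) := by
    refine monotoneOn_of_hasDerivWithinAt_nonneg (convex_Ici 0)
      (fun t _ => ((hp t).add ((hasDerivAt_id t).const_mul μ)).continuousAt.continuousWithinAt)
      (fun t _ => ((hp t).add ((hasDerivAt_id t).const_mul μ)).hasDerivWithinAt) fun t ht => ?_
    rw [interior_Ici] at ht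
    have ht : 0 < t := ht
    have hc := clamp_nonpos (m := μ * |t|) (by positivity)
      (truncated_deriv_nonpos hμ hp0 hp ht.le)
    have hw : 0 ≤ a + 1 / (3 * max (q t) (ε t)) := by
      have := (hpos t).trans_le (le_max_right (q t) (ε t))
      positivity
    have := mul_nonneg (mul_nonneg ht.le (neg_nonneg.2 hc)) hw
    linarith
  have h := hmono (Set.self_mem_Ici) (Set.mem_Ici.2 hs) hs
  simp only [hp0] at h
  linarith

theorem clamp_truncated_deriv (ha : 0 < a) (hμ : 0 < μ) (hpos : ∀ s, 0 < ε s) (hp0 : p 0 = 0)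
    (hp : ∀ s, HasDerivAt p
      (-μ - s * clamp (μ * |s|) (p s) * (a + 1 / (3 * max (q s) (ε s)))) s)
    (hs : 0 ≤ s) : clamp (μ * |s|) (p s) = p s := by
  refine clamp_of_abs_le ?_
  rw [abs_of_nonneg hs, abs_of_nonpos (truncated_deriv_nonpos hμ hp0 hp hs)]
  linarith [truncated_neg_mul_le_deriv ha hμ hpos hp0 hp hs]

/-- As long as `q` has not dropped below the truncation level, it stays above an explicit
exponential. -/
theorem exp_le_of_forall_lt {r : ℝ} (ha : 0 < a) (hA : 0 < A) (hμ : 0 < μ) (hr : 0 < r)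
    (hrA : μ * r ^ 2 = A) (hs : 0 ≤ s) (hq0 : q 0 = A)
    (hq : ∀ t, 0 ≤ t → HasDerivAt q (p t) t)
    (hp : ∀ t, 0 ≤ t → t < s → HasDerivAt p (-μ - t * p t * (a + 1 / (3 * q t))) t)
    (hpc : Continuous p) (hqpos : ∀ t, 0 ≤ t → t ≤ s → 0 < q t)
    (hp_nonpos : ∀ t, 0 ≤ t → p t ≤ 0) (hp_ge : ∀ t, 0 ≤ t → -(μ * t) ≤ p t) :
    A / 2 * exp (-(3 * μ / r * s)) ≤ q s := by
  have hparab (t : ℝ) (ht : 0 ≤ t) : A - μ * t ^ 2 / 2 ≤ q t := by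
    have hd (u : ℝ) (hu : 0 ≤ u) : HasDerivAt (fun u => q u + μ * u ^ 2 / 2) (p u + μ * u) u := by
      have := (hq u hu).add ((((hasDerivAt_id u).pow 2).const_mul μ).div_const 2)
      refine this.congr_deriv ?_
      simp
      ring
    have hmono : MonotoneOn (fun u => q u + μ * u ^ 2 / 2) (Set.Ici 0) := by
      refine monotoneOn_of_hasDerivWithinAt_nonneg (convex_Ici 0)
        (fun u hu => (hd u hu).continuousAt.continuousWithinAt)
        (fun u hu => (hd u (interior_subset hu)).hasDerivWithinAt) fun u hu => ?_
      have := hp_ge u (interior_subset hu)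
      linarith
    have h := hmono (Set.self_mem_Ici) (Set.mem_Ici.2 ht) ht
    simp only [hq0] at h
    linarith
  rcases le_total s r with h | h
  · have h1 := hparab s hs
    have h2 : μ * s ^ 2 ≤ A := by rw [← hrA]; gcongr
    have h3 : exp (-(3 * μ / r * s)) ≤ 1 := by
      rw [Real.exp_le_one_iff]
      have : 0 ≤ 3 * μ / r * s := by positivity
      linarith
    nlinarith
  · have hqr : A / 2 ≤ q r := by
      have := hparab r hr.le
      rw [hrA] at this
      linarith
    have hmono : MonotoneOn (fun t => p t + μ * t + r / 3 * log (q t)) (Set.Icc r s) := by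
      refine monotoneOn_of_hasDerivWithinAt_nonneg (convex_Icc r s)
        (f' := fun t => (-μ - t * p t * (a + 1 / (3 * q t))) + μ + r / 3 * (p t / q t)) ?_ ?_ ?_
      · intro t ht
        have ht0 : 0 ≤ t := hr.le.trans ht.1
        exact ((hpc.continuousAt.add (by fun_prop)).add
          (((hq t ht0).continuousAt.log (hqpos t ht0 ht.2).ne').const_mul _)).continuousWithinAt
      · intro t ht
        rw [interior_Icc] at ht
        have ht0 : 0 ≤ t := hr.le.trans ht.1.le
        have h1 := ((hp t ht0 ht.2).add ((hasDerivAt_id t).const_mul μ)).add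
          (((hq t ht0).log (hqpos t ht0 ht.2.le).ne').const_mul (r / 3))
        exact (h1.congr_deriv (by simp)).hasDerivWithinAt
      · intro t ht
        rw [interior_Icc] at ht
        have ht0 : 0 ≤ t := hr.le.trans ht.1.le
        have hqt := hqpos t ht0 ht.2.le
        have e : -μ - t * p t * (a + 1 / (3 * q t)) + μ + r / 3 * (p t / q t) =
            -p t * (t * a + (t - r) / (3 * q t)) := by
          field_simp
          ring
        rw [e]
        have := hp_nonpos t ht0
        have h2 : 0 ≤ t - r := by linarith [ht.1]
        exact mul_nonneg (by linarith) (by positivity)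
    have h1 := hmono ⟨le_rfl, h⟩ ⟨h, le_rfl⟩ h
    simp only at h1
    have h2 := hp_ge r hr.le
    have h3 := hp_nonpos s hs
    have h4 : log (A / 2) ≤ log (q r) := Real.log_le_log (by positivity) hqr
    have h5 : r / 3 * (log (A / 2) - 3 * μ / r * s) ≤ r / 3 * log (q s) := by
      have e : r / 3 * (log (A / 2) - 3 * μ / r * s) = r / 3 * log (A / 2) - μ * s := by
        field_simp
      have : r / 3 * log (A / 2) ≤ r / 3 * log (q r) := by gcongr
      rw [e]
      linarith
    have h6 : log (A / 2) - 3 * μ / r * s ≤ log (q s) := le_of_mul_le_mul_left h5 (by positivity)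
    have h7 := Real.exp_le_exp.2 h6
    rwa [Real.exp_log (hqpos s hs le_rfl), sub_eq_add_neg, Real.exp_add,
      Real.exp_log (by positivity)] at h7

/-- The lower truncation is never active when its level decays fast enough. -/
theorem truncation_le {r : ℝ} (ha : 0 < a) (hA : 0 < A) (hμ : 0 < μ) (hr : 0 < r)
    (hrA : μ * r ^ 2 = A) (hε : ∀ s, 0 ≤ s → ε s = A / 4 * exp (-(3 * μ / r * s)))
    (hpos : ∀ s, 0 < ε s) (hεc : Continuous ε) (hs : 0 ≤ s) (hq0 : q 0 = A) (hp0 : p 0 = 0)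
    (hq : ∀ s, HasDerivAt q (clamp (μ * |s|) (p s)) s)
    (hp : ∀ s, HasDerivAt p
      (-μ - s * clamp (μ * |s|) (p s) * (a + 1 / (3 * max (q s) (ε s)))) s) :
    ε s ≤ q s := by
  by_contra! hlt
  have hqc : Continuous q := continuous_iff_continuousAt.2 fun t => (hq t).continuousAt
  have hpc : Continuous p := continuous_iff_continuousAt.2 fun t => (hp t).continuousAt
  have hcl (t : ℝ) (ht : 0 ≤ t) : clamp (μ * |t|) (p t) = p t :=
    clamp_truncated_deriv ha hμ hpos hp0 hp ht
  obtain ⟨t, ⟨⟨ht0, hts⟩, htε⟩, hmin⟩ :=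
    (isCompact_Icc.inter_right (isClosed_le hqc hεc) :
      IsCompact (Set.Icc 0 s ∩ {t | q t ≤ ε t})).exists_isLeast ⟨s, ⟨hs, le_rfl⟩, hlt.le⟩
  have hbefore (u : ℝ) (hu0 : 0 ≤ u) (hut : u < t) : ε u < q u := by
    by_contra! h
    exact hut.not_ge (hmin ⟨⟨hu0, hut.le.trans hts⟩, h⟩)
  have ht_ne : t ≠ 0 := by
    rintro rfl
    have := hε 0 le_rfl
    simp only [mul_zero, neg_zero, exp_zero, mul_one] at this
    have htε : q 0 ≤ ε 0 := htε
    linarith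
  have ht_pos : 0 < t := lt_of_le_of_ne ht0 ht_ne.symm
  have hat : ε t ≤ q t := by
    have hmem : t ∈ closure (Set.Ico 0 t) := by
      rw [closure_Ico ht_ne.symm]
      exact ⟨ht0, le_rfl⟩
    exact closure_minimal (fun u hu => (hbefore u hu.1 hu.2).le) (isClosed_le hεc hqc) hmem
  have hge := exp_le_of_forall_lt ha hA hμ hr hrA ht0 hq0
    (fun u hu => by simpa only [hcl u hu] using hq u)
    (fun u hu hut => by
      simpa only [hcl u hu, max_eq_left (hbefore u hu hut).le] using hp u) hpc
    (fun u hu hut => (hpos u).trans_le <| by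
      rcases hut.lt_or_eq with h | rfl
      · exact (hbefore u hu h).le
      · exact hat)
    (fun u hu => truncated_deriv_nonpos hμ hp0 hp hu)
    (fun u hu => truncated_neg_mul_le_deriv ha hμ hpos hp0 hp hu)
  have h1 := hε t ht0
  have h2 := exp_pos (-(3 * μ / r * t))
  have htε : q t ≤ ε t := htε
  nlinarith

end Bounds

/-- The untruncated initial value problem has a global positive even solution. -/
theorem exists_global_positive_solution {a μ A : ℝ} (ha : 0 < a) (hμ : 0 < μ) (hA : 0 < A) :
    ∃ q p : ℝ → ℝ, q 0 = A ∧ p 0 = 0 ∧ (∀ s, 0 < q s) ∧ (∀ s, q (-s) = q s) ∧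
      (∀ s, p (-s) = -p s) ∧ (∀ s, 0 ≤ s → p s ≤ 0) ∧ (∀ s, 0 ≤ s → -(μ * s) ≤ p s) ∧
      (∀ s, HasDerivAt q (p s) s) ∧
      ∀ s, HasDerivAt p (-μ - s * p s * (a + 1 / (3 * q s))) s := by
  set r := √(A / μ) with hr_def
  have hr : 0 < r := Real.sqrt_pos.2 (by positivity)
  have hrA : μ * r ^ 2 = A := by
    rw [hr_def, Real.sq_sqrt (by positivity)]
    field_simp
  set ε : ℝ → ℝ := fun s => A / 4 * exp (-(3 * μ / r * |s|)) with hε_def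
  have hεc : Continuous ε := by fun_prop
  have hpos (s : ℝ) : 0 < ε s := by positivity
  have heven (s : ℝ) : ε (-s) = ε s := by simp [hε_def]
  obtain ⟨q, p, hq0, hp0, hqe, hpo, hq, hp⟩ := exists_truncated_solution (A := A) ha hμ hεc hpos
    heven (fun s T h => by
      have h' : |s| ≤ |T| := h.trans (le_abs_self T)
      simp only [hε_def]
      gcongr)
  have hnonpos (s : ℝ) (hs : 0 ≤ s) := truncated_deriv_nonpos hμ hp0 hp hs
  have hge (s : ℝ) (hs : 0 ≤ s) := truncated_neg_mul_le_deriv ha hμ hpos hp0 hp hs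
  have habs (s : ℝ) : clamp (μ * |s|) (p s) = p s := by
    rcases le_total 0 s with hs | hs
    · exact clamp_truncated_deriv ha hμ hpos hp0 hp hs
    · have h := clamp_truncated_deriv ha hμ hpos hp0 hp (neg_nonneg.2 hs)
      rwa [abs_neg, hpo, clamp_neg (by positivity), neg_inj] at h
  have hεq' (s : ℝ) (hs : 0 ≤ s) : ε s ≤ q s :=
    truncation_le ha hA hμ hr hrA (fun t ht => by simp [hε_def, abs_of_nonneg ht]) hpos hεc hs
      hq0 hp0 hq hp
  have hεq (s : ℝ) : ε s ≤ q s := by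
    rcases le_total 0 s with hs | hs
    · exact hεq' s hs
    · simpa only [heven, hqe] using hεq' (-s) (neg_nonneg.2 hs)
  refine ⟨q, p, hq0, hp0, fun s => (hpos s).trans_le (hεq s), hqe, hpo, hnonpos, hge,
    fun s => by simpa only [habs] using hq s, fun s => ?_⟩
  simpa only [habs, max_eq_left (hεq s)] using hp s

section Asymptotics

variable {a μ : ℝ} {q p : ℝ → ℝ}

theorem exists_le_mul_rpow (ha : 0 < a) (hpos : ∀ s, 0 < q s)
    (hp_nonpos : ∀ s, 0 ≤ s → p s ≤ 0) (hp_ge : ∀ s, 0 ≤ s → -(μ * s) ≤ p s)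
    (hq : ∀ s, HasDerivAt q (p s) s)
    (hp : ∀ s, HasDerivAt p (-μ - s * p s * (a + 1 / (3 * q s))) s) :
    ∃ C : ℝ, 0 < C ∧ ∀ s, 1 ≤ s → q s ≤ C * s ^ (-(3 * μ)) := by
  set K : ℝ → ℝ := fun t => a * q t + 1 / 3 * log (q t) + μ * log t + p t / t + q t with hK
  have hd (t : ℝ) (ht : 1 ≤ t) : HasDerivAt K (p t * (1 - 1 / t ^ 2)) t := by
    have ht0 : 0 < t := by linarith
    have hqt := hpos t
    have h := (((((hq t).const_mul a).add (((hq t).log hqt.ne').const_mul (1 / 3))).add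
      ((Real.hasDerivAt_log ht0.ne').const_mul μ)).add
      ((hp t).div (hasDerivAt_id t) ht0.ne')).add (hq t)
    refine h.congr_deriv ?_
    simp only [id]
    field_simp
    ring
  have hanti : AntitoneOn K (Set.Ici 1) := by
    refine antitoneOn_of_hasDerivWithinAt_nonpos (convex_Ici 1)
      (fun t ht => (hd t ht).continuousAt.continuousWithinAt)
      (fun t ht => (hd t (interior_subset ht)).hasDerivWithinAt) fun t ht => ?_
    have ht1 : 1 ≤ t := interior_subset (s := Set.Ici (1 : ℝ)) ht
    refine mul_nonpos_of_nonpos_of_nonneg (hp_nonpos t (by linarith)) ?_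
    have : 1 / t ^ 2 ≤ 1 := (div_le_one (by positivity)).2 (one_le_pow₀ ht1)
    linarith
  refine ⟨exp (3 * (K 1 + μ)), exp_pos _, fun s hs => ?_⟩
  have hs0 : 0 < s := by linarith
  have h := hanti (Set.self_mem_Ici) (Set.mem_Ici.2 hs) hs
  have hps : -μ ≤ p s / s := by
    rw [le_div_iff₀ hs0]
    linarith [hp_ge s hs0.le]
  have haq : 0 < a * q s := mul_pos ha (hpos s)
  have hqs := hpos s
  have hKs : K s = a * q s + 1 / 3 * log (q s) + μ * log s + p s / s + q s := rfl
  rw [Real.rpow_def_of_pos hs0, ← Real.exp_add, ← Real.log_le_iff_le_exp hqs]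
  linarith

theorem antitoneOn_of_hasDerivAt_nonpos_Ici (hq : ∀ s, HasDerivAt q (p s) s)
    (hp_nonpos : ∀ s, 0 ≤ s → p s ≤ 0) : AntitoneOn q (Set.Ici 0) :=
  antitoneOn_of_hasDerivWithinAt_nonpos (convex_Ici 0)
    (fun t _ => (hq t).continuousAt.continuousWithinAt)
    (fun t _ => (hq t).hasDerivWithinAt) fun t ht => hp_nonpos t (interior_subset ht)

/-- A lower bound for the derivative of a positive function whose derivative `p` satisfies the
one-sided Lipschitz condition that `p + μ s` is nondecreasing. -/
theorem deriv_ge_of_monotoneOn {s h : ℝ} (hμ : 0 ≤ μ) (hpos : ∀ s, 0 < q s)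
    (hq : ∀ s, HasDerivAt q (p s) s)
    (hmono : MonotoneOn (fun s => p s + μ * s) (Set.Ici 0)) (hh : 0 < h) (hs : h ≤ s) :
    -(q (s - h) / h) - μ * h ≤ p s := by
  obtain ⟨ξ, hξ, hξ'⟩ := exists_hasDerivAt_eq_slope q p (by linarith : s - h < s)
    (fun t _ => (hq t).continuousAt.continuousWithinAt) (fun t _ => hq t)
  have h0 : 0 ≤ ξ := by linarith [hξ.1]
  have h1 := hmono (Set.mem_Ici.2 h0) (Set.mem_Ici.2 (h0.trans hξ.2.le)) hξ.2.le
  simp only [sub_sub_cancel] at h1 hξ'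
  have h2 : -(q (s - h) / h) ≤ p ξ := by
    rw [hξ', ← neg_div]
    gcongr
    linarith [hpos s]
  nlinarith [hξ.1]

theorem tendsto_deriv_zero_of_monotoneOn (hμ : 0 < μ) (hpos : ∀ s, 0 < q s)
    (hq : ∀ s, HasDerivAt q (p s) s) (hp_nonpos : ∀ s, 0 ≤ s → p s ≤ 0)
    (hmono : MonotoneOn (fun s => p s + μ * s) (Set.Ici 0)) (hlim : Tendsto q atTop (nhds 0)) :
    Tendsto p atTop (nhds 0) := by
  rw [Metric.tendsto_atTop']
  intro δ hδ
  set h := δ / (2 * μ) with hh_def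
  have hh : 0 < h := by positivity
  have hμh : μ * h = δ / 2 := by rw [hh_def]; field_simp
  have hshift : Tendsto (fun s => q (s - h) / h) atTop (nhds 0) := by
    have := (hlim.comp (tendsto_atTop_add_const_right atTop (-h) tendsto_id)).div_const h
    simpa [Function.comp_def, sub_eq_add_neg] using this
  obtain ⟨N, hN⟩ := eventually_atTop.1 (hshift.eventually_lt_const (by positivity : 0 < δ / 2))
  refine ⟨max N h, fun s hs => ?_⟩
  have h1 := hN s ((le_max_left _ _).trans hs.le)
  have hhs : h ≤ s := (le_max_right _ _).trans hs.le
  have h2 := deriv_ge_of_monotoneOn hμ.le hpos hq hmono hh hhs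
  have h3 := hp_nonpos s (hh.le.trans hhs)
  rw [Real.dist_eq, sub_zero, abs_of_nonpos h3]
  linarith

theorem monotoneOn_deriv_add (ha : 0 < a) (hpos : ∀ s, 0 < q s)
    (hp_nonpos : ∀ s, 0 ≤ s → p s ≤ 0)
    (hp : ∀ s, HasDerivAt p (-μ - s * p s * (a + 1 / (3 * q s))) s) :
    MonotoneOn (fun s => p s + μ * s) (Set.Ici 0) := by
  refine monotoneOn_of_hasDerivWithinAt_nonneg (convex_Ici 0)
    (fun t _ => ((hp t).add ((hasDerivAt_id t).const_mul μ)).continuousAt.continuousWithinAt)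
    (fun t _ => ((hp t).add ((hasDerivAt_id t).const_mul μ)).hasDerivWithinAt) fun t ht => ?_
  have ht0 : 0 ≤ t := interior_subset (s := Set.Ici (0 : ℝ)) ht
  have hqt := hpos t
  have := mul_nonneg (mul_nonneg ht0 (neg_nonneg.2 (hp_nonpos t ht0)))
    (by positivity : 0 ≤ a + 1 / (3 * q t))
  linarith

theorem deriv_neg_of_pos {s : ℝ} (hμ : 0 < μ) (hp_nonpos : ∀ s, 0 ≤ s → p s ≤ 0)
    (hp : ∀ s, HasDerivAt p (-μ - s * p s * (a + 1 / (3 * q s))) s) (hs : 0 < s) : p s < 0 := by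
  refine (hp_nonpos s hs.le).lt_of_ne fun h0 => ?_
  have hmax : IsLocalMax p s := by
    filter_upwards [lt_mem_nhds hs] with t ht
    rw [h0]
    exact hp_nonpos t ht.le
  have h := hmax.hasDerivAt_eq_zero (hp s)
  rw [h0] at h
  simp only [mul_zero, zero_mul] at h
  linarith

end Asymptotics

theorem stmt_0 (a μ A : ℝ) (ha : 0 < a) (hμ : 1 / 3 < μ) (hA : 0 < A) :
    ∃ q : ℝ → ℝ, ContDiff ℝ 2 q ∧
      (∀ s : ℝ, deriv (deriv q) s * q s + a * s * deriv q s * q s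
        + μ * q s + (1 / 3) * s * deriv q s = 0) ∧
      q 0 = A ∧ deriv q 0 = 0 ∧
      (∀ s : ℝ, 0 < q s) ∧
      (∀ s : ℝ, q (-s) = q s) ∧
      StrictAntiOn q (Set.Ioi 0) ∧
      Tendsto q atTop (nhds 0) ∧
      Tendsto (deriv q) atTop (nhds 0) ∧
      Integrable q ∧
      Integrable (fun s : ℝ => q s ^ 2) ∧
      Integrable (fun s : ℝ => deriv q s ^ 2) ∧
      (μ - 1 / 3) * ∫ s : ℝ, q s
        = (∫ s : ℝ, deriv q s ^ 2) + (a / 2) * ∫ s : ℝ, q s ^ 2 := by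
  have hμ0 : 0 < μ := by linarith
  obtain ⟨q, p, hq0, hp0, hpos, hqe, hpo, hp_nonpos, hp_ge, hq, hp⟩ :=
    exists_global_positive_solution (a := a) ha hμ0 hA
  have hdq : deriv q = p := funext fun s => (hq s).deriv
  have hqc : Continuous q := continuous_iff_continuousAt.2 fun t => (hq t).continuousAt
  have hpc : Continuous p := continuous_iff_continuousAt.2 fun t => (hp t).continuousAt
  have hdp : deriv p = fun s => -μ - s * p s * (a + 1 / (3 * q s)) :=
    funext fun s => (hp s).deriv
  have hmono := monotoneOn_deriv_add ha hpos hp_nonpos hp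
  obtain ⟨C, hC, hdecay⟩ := exists_le_mul_rpow ha hpos hp_nonpos hp_ge hq hp
  have hqlim : Tendsto q atTop (nhds 0) := by
    have h : Tendsto (fun s : ℝ => C * s ^ (-(3 * μ))) atTop (nhds 0) := by
      simpa using (tendsto_rpow_neg_atTop (by positivity : 0 < 3 * μ)).const_mul C
    refine squeeze_zero' (Eventually.of_forall fun s => (hpos s).le) ?_ h
    filter_upwards [eventually_ge_atTop 1] with s hs using hdecay s hs
  have hsqlim : Tendsto (fun s => s * q s) atTop (nhds 0) := by
    have h : Tendsto (fun s : ℝ => C * s ^ (-(3 * μ - 1))) atTop (nhds 0) := by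
      simpa using (tendsto_rpow_neg_atTop (by linarith : 0 < 3 * μ - 1)).const_mul C
    refine squeeze_zero' ?_ ?_ h
    · filter_upwards [eventually_ge_atTop 0] with s hs using mul_nonneg hs (hpos s).le
    · filter_upwards [eventually_ge_atTop 1] with s hs
      have hs0 : 0 < s := by linarith
      calc s * q s ≤ s * (C * s ^ (-(3 * μ))) := by gcongr; exact hdecay s hs
        _ = C * (s ^ (-(3 * μ)) * s ^ (1 : ℝ)) := by rw [Real.rpow_one]; ring
        _ = C * s ^ (-(3 * μ - 1)) := by rw [← Real.rpow_add hs0]; ring_nf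
  have hplim := tendsto_deriv_zero_of_monotoneOn hμ0 hpos hq hp_nonpos hmono hqlim
  have hanti := antitoneOn_of_hasDerivAt_nonpos_Ici hq hp_nonpos
  have hqA' (s : ℝ) (hs : 0 ≤ s) : q s ≤ A :=
    (hanti Set.self_mem_Ici (Set.mem_Ici.2 hs) hs).trans_eq hq0
  have hqA (s : ℝ) : q s ≤ A := by
    rcases le_total 0 s with hs | hs
    · exact hqA' s hs
    · simpa only [hqe] using hqA' (-s) (neg_nonneg.2 hs)
  have hp_bound (s : ℝ) (hs : 0 ≤ s) : -(A + μ) ≤ p s := by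
    rcases le_total s 1 with h | h
    · have := hp_ge s hs
      nlinarith
    · have := deriv_ge_of_monotoneOn hμ0.le hpos hq hmono one_pos h
      have := hqA (s - 1)
      simp only [div_one, mul_one] at *
      linarith
  have hqint : Integrable q := by
    refine integrable_of_even hqe ?_
    rw [← Set.Ioc_union_Ioi_eq_Ioi zero_le_one]
    refine IntegrableOn.union
      (hqc.continuousOn.integrableOn_Icc.mono_set Set.Ioc_subset_Icc_self) ?_
    refine Integrable.mono' (((integrableOn_Ioi_rpow_of_lt (by linarith : -(3 * μ) < -1)
      one_pos).const_mul C)) hqc.aestronglyMeasurable ?_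
    filter_upwards [ae_restrict_mem measurableSet_Ioi] with s hs
    rw [Real.norm_of_nonneg (hpos s).le]
    exact hdecay s (le_of_lt hs)
  have hq2int : Integrable fun s => q s ^ 2 := by
    refine (hqint.const_mul A).mono' (by fun_prop) (Eventually.of_forall fun s => ?_)
    rw [Real.norm_of_nonneg (by positivity), sq]
    exact mul_le_mul_of_nonneg_right (hqA s) (hpos s).le
  have hp2int : Integrable fun s => p s ^ 2 := by
    refine integrable_of_even (fun s => by rw [hpo, neg_sq]) ?_
    have hpint : IntegrableOn p (Set.Ioi 0) := integrableOn_Ioi_deriv_of_nonpos'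
      (fun s _ => hq s) (fun s hs => hp_nonpos s (le_of_lt hs)) hqlim
    refine (hpint.const_mul (-(A + μ))).mono' (by fun_prop) ?_
    filter_upwards [ae_restrict_mem measurableSet_Ioi] with s hs
    have hs0 : 0 ≤ s := le_of_lt hs
    rw [Real.norm_of_nonneg (by positivity), sq]
    exact mul_le_mul_of_nonpos_right (hp_bound s hs0) (hp_nonpos s hs0)
  refine ⟨q, ?_, fun s => ?_, hq0, ?_, hpos, hqe, ?_, hqlim, ?_, hqint, hq2int, ?_, ?_⟩
  · rw [show (2 : WithTop ℕ∞) = 1 + 1 by norm_num, contDiff_succ_iff_deriv]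
    refine ⟨fun s => (hq s).differentiableAt, by simp, ?_⟩
    rw [hdq, contDiff_one_iff_deriv, hdp]
    refine ⟨fun s => (hp s).differentiableAt, ?_⟩
    have : Continuous fun s => 1 / (3 * q s) :=
      continuous_const.div (by fun_prop) fun s => by have := hpos s; positivity
    fun_prop
  · have := hpos s
    simp only [hdq, hdp]
    field_simp
    ring
  · rw [hdq, hp0]
  · refine strictAntiOn_of_hasDerivWithinAt_neg (convex_Ioi 0) hqc.continuousOn
      (fun s _ => (hq s).hasDerivWithinAt) fun s hs => ?_
    exact deriv_neg_of_pos hμ0 hp_nonpos hp (interior_subset (s := Set.Ioi (0 : ℝ)) hs)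
  · rwa [hdq]
  · rwa [hdq]
  · rw [hdq]
    set F : ℝ → ℝ := fun s => q s * p s + a / 2 * (s * q s * q s) + 1 / 3 * (s * q s) with hF
    have hFd (s : ℝ) :
        HasDerivAt F (p s ^ 2 + a / 2 * q s ^ 2 - (μ - 1 / 3) * q s) s := by
      have hsq := (hasDerivAt_id s).mul (hq s)
      have h := (((hq s).mul (hp s)).add ((hsq.mul (hq s)).const_mul (a / 2))).add
        (hsq.const_mul (1 / 3))
      refine h.congr_deriv ?_
      have := hpos s
      simp only [id, Pi.mul_apply]
      field_simp
      ring
    have htop : Tendsto F atTop (nhds 0) := by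
      simpa using ((hqlim.mul hplim).add ((hsqlim.mul hqlim).const_mul (a / 2))).add
        (hsqlim.const_mul (1 / 3))
    have hFodd (s : ℝ) : F (-s) = -F s := by
      simp only [hF, hqe, hpo]
      ring
    have hbot : Tendsto F atBot (nhds 0) := by
      have h := (htop.comp tendsto_neg_atBot_atTop).neg
      simpa [Function.comp_def, hFodd] using h
    have hi1 := hq2int.const_mul (a / 2)
    have hi2 := hqint.const_mul (μ - 1 / 3)
    have hi3 : Integrable fun s => p s ^ 2 + a / 2 * q s ^ 2 := hp2int.add hi1
    have hzero := integral_of_hasDerivAt_of_tendsto hFd (hi3.sub hi2) hbot htop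
    rw [integral_sub hi3 hi2, integral_add hp2int hi1, integral_const_mul,
      integral_const_mul] at hzero
    linarith
end

section
/- For every s > 0 one has q'(s) < 0; consequently q is strictly decreasing on (0, ∞) and 0 < q(s) < A for all s > 0. -/
open MeasureTheory Filter Real

/-- A differentiable function that vanishes at the origin and has negative derivative at each of its
zeros is negative on the positive half-line. -/
theorem neg_of_deriv_neg_of_eq_zero {f : ℝ → ℝ} (hf : Differentiable ℝ f) (h0 : f 0 = 0)
    (hneg : ∀ x, f x = 0 → deriv f x < 0) {s : ℝ} (hs : 0 < s) : f s < 0 := by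
  have hle : ∀ x, 0 ≤ x → f x ≤ 0 := fun x hx =>
    image_le_of_deriv_right_lt_deriv_boundary (B := fun _ => 0) (B' := fun _ => 0)
      hf.continuous.continuousOn (fun y _ => (hf y).hasDerivAt.hasDerivWithinAt) h0.le
      (fun y => hasDerivAt_const y 0) (fun y _ hy => hneg y hy) (Set.right_mem_Icc.2 hx)
  refine (hle s hs.le).lt_of_ne fun hzero => ?_
  have hmax : IsLocalMax f s := by
    filter_upwards [Ioi_mem_nhds hs] with x hx
    exact (hle x (le_of_lt hx)).trans_eq hzero.symm
  exact (hneg s hzero).ne hmax.deriv_eq_zero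

theorem stmt_2 (a μ A : ℝ) (ha : 0 < a) (hμ : 1 / 3 < μ) (hA : 0 < A)
    (q : ℝ → ℝ) (hq : ContDiff ℝ 2 q)
    (hode : ∀ s : ℝ, deriv (deriv q) s * q s + a * s * deriv q s * q s
      + μ * q s + (1 / 3) * s * deriv q s = 0)
    (hq0 : q 0 = A) (hq0' : deriv q 0 = 0)
    (hpos : ∀ s : ℝ, 0 < q s) :
    (∀ s : ℝ, 0 < s → deriv q s < 0) ∧
    StrictAntiOn q (Set.Ioi 0) ∧
    (∀ s : ℝ, 0 < s → 0 < q s ∧ q s < A) := by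
  have hdiff : Differentiable ℝ (deriv q) := by
    simpa using hq.differentiable_iteratedDeriv 1 (by norm_num)
  have hderiv : ∀ s : ℝ, 0 < s → deriv q s < 0 := fun s hs => by
    refine neg_of_deriv_neg_of_eq_zero hdiff hq0' (fun x hx => ?_) hs
    have hx' := hode x
    simp only [hx, mul_zero, zero_mul, add_zero, ← add_mul] at hx'
    have := (mul_eq_zero.1 hx').resolve_right (hpos x).ne'
    linarith
  have hanti : StrictAntiOn q (Set.Ici 0) :=
    strictAntiOn_of_deriv_neg (convex_Ici 0) hq.continuous.continuousOn fun x hx =>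
      hderiv x (by simpa using hx)
  exact ⟨hderiv, hanti.mono Set.Ioi_subset_Ici_self, fun s hs =>
    ⟨hpos s, hq0 ▸ hanti Set.self_mem_Ici hs.le hs⟩⟩
end
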